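/- Let λ ∈ ℝ, let α > 0, let Y be a Poisson random variable with parameter α, and let x ∈ [0,1]. Then for real t near 0, (E[e_λ^Y(t)])^{1−x} = e^{α(1−x)(e_λ(t)−1)}, and this function has Taylor expansion ∑_{n≥0} φ_{n,λ}(α(1−x)) t^n/n!, where φ_{n,λ} are the degenerate Bell polynomials. -/

import Mathlib

open MeasureTheory Filter Finset Topology

/-- The degenerate falling factorial `(x)_{n,λ} = x(x-λ)(x-2λ)⋯(x-(n-1)λ)`. -/
noncomputable def degFallFac (lam x : ℝ) : ℕ → ℝ
  | 0 => 1
  | n + 1 => degFallFac lam x n * (x - n * lam)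

/-- The degenerate exponential `e_λ^y(t) = (1+λt)^{y/λ}` for `λ ≠ 0`, and `e^{yt}` for `λ = 0`. -/
noncomputable def degExp (lam y t : ℝ) : ℝ :=
  if lam = 0 then Real.exp (y * t) else (1 + lam * t) ^ (y / lam)

/-- The generalized binomial coefficient `C(a,j) = a(a-1)⋯(a-j+1)/j!`. -/
noncomputable def genBinom (a : ℝ) (j : ℕ) : ℝ :=
  (∏ i ∈ Finset.range j, (a - (i : ℝ))) / (j.factorial : ℝ)

/-- The degenerate binomial coefficient `C_λ(x,k) = (x)_{k,λ}/k!`. -/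
noncomputable def degBinom (lam x : ℝ) (k : ℕ) : ℝ :=
  degFallFac lam x k / (k.factorial : ℝ)

/-- A probability law on `ℝ` whose point masses at the naturals are the Poisson weights is the
Poisson law. -/
lemma map_eq_map_cast_poissonMeasure {Ω : Type*} [MeasurableSpace Ω] {μ : Measure Ω}
    [IsProbabilityMeasure μ] {Y : Ω → ℝ} (hYm : Measurable Y) (r : NNReal)
    (hlaw : ∀ j : ℕ, μ {ω | Y ω = (j : ℝ)}
      = ENNReal.ofReal (Real.exp (-r) * (r : ℝ) ^ j / (j.factorial : ℝ))) :
    μ.map Y = (ProbabilityTheory.poissonMeasure r).map (Nat.cast : ℕ → ℝ) := by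
  have hY : IsProbabilityMeasure (μ.map Y) := Measure.isProbabilityMeasure_map hYm.aemeasurable
  have hcomap : ProbabilityTheory.poissonMeasure r = (μ.map Y).comap (Nat.cast : ℕ → ℝ) := by
    refine Measure.ext_of_singleton fun n ↦ ?_
    rw [ProbabilityTheory.poissonMeasure_singleton,
      Nat.isClosedEmbedding_coe_real.measurableEmbedding.comap_apply, Set.image_singleton,
      Measure.map_apply hYm (measurableSet_singleton _), ← hlaw n]
    rfl
  symm
  refine Measure.eq_of_le_of_isProbabilityMeasure ?_
  rw [hcomap, Nat.isClosedEmbedding_coe_real.measurableEmbedding.map_comap]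
  exact Measure.restrict_le_self

lemma degExp_natCast {lam t : ℝ} (ht : 0 < 1 + lam * t) (n : ℕ) :
    degExp lam n t = degExp lam 1 t ^ n := by
  unfold degExp
  split_ifs with h
  · rw [one_mul, Real.exp_nat_mul]
  · rw [← Real.rpow_mul_natCast ht.le, one_div_mul_eq_div]

lemma measurable_degExp (lam t : ℝ) : Measurable fun y ↦ degExp lam y t := by
  unfold degExp
  split_ifs <;> fun_prop

lemma integral_degExp_poissonMeasure (r : NNReal) {lam t : ℝ} (ht : 0 < 1 + lam * t) :
    ∫ n : ℕ, degExp lam n t ∂(ProbabilityTheory.poissonMeasure r)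
      = Real.exp (r * (degExp lam 1 t - 1)) := by
  rw [ProbabilityTheory.integral_poissonMeasure]
  have h := (NormedSpace.expSeries_div_hasSum_exp ((r : ℝ) * degExp lam 1 t)).mul_left
    (Real.exp (-r))
  rw [← Real.exp_eq_exp_ℝ, ← Real.exp_add] at h
  convert! h.tsum_eq using 2
  · ext n
    rw [degExp_natCast ht, mul_pow, smul_eq_mul]
    ring
  · ring_nf

lemma degExp_zero_right (lam y : ℝ) : degExp lam y 0 = 1 := by
  simp [degExp]

lemma eventually_one_add_mul_pos (lam : ℝ) : ∀ᶠ t in 𝓝 (0 : ℝ), 0 < 1 + lam * t :=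
  ContinuousAt.eventually_lt (by fun_prop) (by fun_prop) (by simp)

lemma analyticAt_degExp (lam y : ℝ) : AnalyticAt ℝ (degExp lam y) 0 := by
  by_cases h : lam = 0
  · have : degExp lam y = fun t ↦ Real.exp (y * t) := by
      ext t
      simp [degExp, h]
    rw [this]
    fun_prop
  · have han : AnalyticAt ℝ (fun t ↦ Real.exp (Real.log (1 + lam * t) * (y / lam))) 0 :=
      (((by fun_prop : AnalyticAt ℝ (fun t : ℝ ↦ 1 + lam * t) 0).log (by simp)).mul
        analyticAt_const).rexp'
    refine han.congr ?_
    filter_upwards [eventually_one_add_mul_pos lam] with t ht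
    rw [degExp, if_neg h, Real.rpow_def_of_pos ht]

lemma AnalyticAt.eventually_hasSum_iteratedDeriv {f : ℝ → ℝ} (hf : AnalyticAt ℝ f 0) :
    ∀ᶠ t in 𝓝 (0 : ℝ),
      HasSum (fun n : ℕ ↦ iteratedDeriv n f 0 * t ^ n / (n.factorial : ℝ)) (f t) := by
  filter_upwards [hasFPowerSeriesAt_iff.mp hf.hasFPowerSeriesAt] with t ht
  simp only [FormalMultilinearSeries.coeff_ofScalars, zero_add, smul_eq_mul] at ht
  convert! ht using 2 with n
  ring

lemma iteratedDeriv_eq_of_eventually_hasSum {f : ℝ → ℝ} {a : ℕ → ℝ}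
    (hf : ∀ᶠ t in 𝓝 (0 : ℝ), HasSum (fun n : ℕ ↦ a n * t ^ n / (n.factorial : ℝ)) (f t))
    (n : ℕ) : iteratedDeriv n f 0 = a n := by
  have hp : HasFPowerSeriesAt f
      (FormalMultilinearSeries.ofScalars ℝ fun n ↦ a n / (n.factorial : ℝ)) 0 := by
    rw [hasFPowerSeriesAt_iff]
    filter_upwards [hf] with t ht
    simp only [FormalMultilinearSeries.coeff_ofScalars, zero_add, smul_eq_mul]
    convert! ht using 2 with n
    ring
  have h := congrArg (fun p ↦ p.coeff n)
    (hp.analyticAt.hasFPowerSeriesAt.eq_formalMultilinearSeries hp)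
  simpa [FormalMultilinearSeries.coeff_ofScalars, div_left_inj', Nat.factorial_ne_zero] using h

lemma iteratedDeriv_pow_mul_eq_zero {f g : ℝ → ℝ} (hf : AnalyticAt ℝ f 0) (hg : AnalyticAt ℝ g 0)
    (hf0 : f 0 = 0) {n m : ℕ} (hnm : n < m) :
    iteratedDeriv n (fun t ↦ f t ^ m * g t) 0 = 0 := by
  have h : (m : ℕ∞) ≤ analyticOrderAt (f ^ m * g) 0 := by
    rw [analyticOrderAt_mul (hf.pow m) hg, analyticOrderAt_pow hf, nsmul_eq_mul]
    refine le_add_right (le_mul_of_one_le_right' ?_)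
    exact Order.one_le_iff_pos.mpr (pos_iff_ne_zero.mpr (hf.analyticOrderAt_ne_zero.mpr hf0))
  exact (natCast_le_analyticOrderAt_iff_iteratedDeriv_eq_zero ((hf.pow m).mul hg)).mp h n hnm

/-- The Taylor coefficients at `0` of `exp (c f)`, when `f 0 = 0`, in terms of those of the
powers of `f`. -/
lemma iteratedDeriv_exp_const_mul_comp {f : ℝ → ℝ} (hf : AnalyticAt ℝ f 0) (hf0 : f 0 = 0)
    (c : ℝ) (n : ℕ) :
    iteratedDeriv n (fun t ↦ Real.exp (c * f t)) 0
      = ∑ k ∈ Finset.range (n + 1),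
        iteratedDeriv n (fun t ↦ 1 / (k.factorial : ℝ) * f t ^ k) 0 * c ^ k := by
  obtain ⟨H, hH, hexp⟩ := AnalyticAt.exists_eq_sum_add_pow_mul
    (by fun_prop : AnalyticAt ℝ (fun u : ℝ ↦ Real.exp (c * u)) 0) (n + 1)
  have hHf : AnalyticAt ℝ (fun t ↦ H (f t)) 0 := AnalyticAt.fun_comp (by rwa [hf0]) hf
  have hsplit : (fun t ↦ Real.exp (c * f t)) = fun t ↦
      (∑ k ∈ Finset.range (n + 1), c ^ k * (1 / (k.factorial : ℝ) * f t ^ k))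
        + f t ^ (n + 1) * H (f t) := by
    ext t
    rw [hexp, smul_eq_mul]
    congr 1
    refine Finset.sum_congr rfl fun k _ ↦ ?_
    rw [iteratedDeriv_exp_const_mul]
    simp
    ring
  have hterm (k : ℕ) : AnalyticAt ℝ (fun t ↦ 1 / (k.factorial : ℝ) * f t ^ k) 0 := by fun_prop
  have hsum : AnalyticAt ℝ (fun t ↦
      ∑ k ∈ Finset.range (n + 1), c ^ k * (1 / (k.factorial : ℝ) * f t ^ k)) 0 := by fun_prop
  have htail : AnalyticAt ℝ (fun t ↦ f t ^ (n + 1) * H (f t)) 0 := (hf.fun_pow _).fun_mul hHf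
  rw [hsplit, iteratedDeriv_fun_add hsum.contDiffAt htail.contDiffAt,
    iteratedDeriv_pow_mul_eq_zero hf hHf hf0 n.lt_succ_self, add_zero,
    iteratedDeriv_fun_sum fun k _ ↦ (analyticAt_const.fun_mul (hterm k)).contDiffAt]
  refine Finset.sum_congr rfl fun k _ ↦ ?_
  rw [iteratedDeriv_const_mul _ (hterm k).contDiffAt, mul_comm]

/-- **Equation (34).** For `Y` Poisson with parameter `α > 0` and `x ∈ [0,1]`: for `t`
near `0`, `(E[e_λ^Y(t)])^{1-x} = e^{α(1-x)(e_λ(t)-1)}`, and this function has the Taylor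
expansion `∑_{n≥0} φ_{n,λ}(α(1-x)) t^n/n!`, where `φ_{n,λ}(y) = ∑_{k=0}^{n} {n brace k}_λ y^k`
are the degenerate Bell polynomials. -/
theorem poisson_expectation_degExp_rpow_eq_exp_and_bell_expansion
    {Ω : Type*} [MeasurableSpace Ω] (μ : Measure Ω) [IsProbabilityMeasure μ]
    (Y : Ω → ℝ) (hYm : Measurable Y)
    (α : ℝ) (hα : 0 < α)
    -- `Y` is Poisson with parameter `α`:
    (hlaw : ∀ j : ℕ, μ {ω | Y ω = (j : ℝ)}
      = ENNReal.ofReal (Real.exp (-α) * α ^ j / (j.factorial : ℝ)))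
    (lam x : ℝ) (hx : x ∈ Set.Icc (0 : ℝ) 1)
    -- degenerate Stirling numbers of the second kind:
    (dSt : ℕ → ℕ → ℝ)
    (hdSt0 : ∀ n k : ℕ, n < k → dSt n k = 0)
    (hdSt : ∀ k : ℕ, ∀ᶠ t in 𝓝 (0 : ℝ),
      HasSum (fun n : ℕ => dSt n k * t ^ n / (n.factorial : ℝ))
        ((1 / (k.factorial : ℝ)) * (degExp lam 1 t - 1) ^ k)) :
    ∀ᶠ t in 𝓝 (0 : ℝ),
      (∫ ω, degExp lam (Y ω) t ∂μ) ^ (1 - x)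
          = Real.exp (α * (1 - x) * (degExp lam 1 t - 1)) ∧
      HasSum
        (fun n : ℕ =>
          (∑ k ∈ Finset.range (n + 1), dSt n k * (α * (1 - x)) ^ k) * t ^ n /
            (n.factorial : ℝ))
        ((∫ ω, degExp lam (Y ω) t ∂μ) ^ (1 - x)) := by
  lift α to NNReal using hα.le
  have hF : AnalyticAt ℝ (fun t ↦ degExp lam 1 t - 1) 0 :=
    (analyticAt_degExp lam 1).sub analyticAt_const
  have hG : AnalyticAt ℝ (fun t ↦ Real.exp (α * (1 - x) * (degExp lam 1 t - 1))) 0 :=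
    (analyticAt_const.mul hF).rexp'
  have hmap := map_eq_map_cast_poissonMeasure hYm α hlaw
  filter_upwards [eventually_one_add_mul_pos lam, hG.eventually_hasSum_iteratedDeriv] with t ht hsum
  have hint : ∫ ω, degExp lam (Y ω) t ∂μ = Real.exp (α * (degExp lam 1 t - 1)) := by
    rw [← integral_map hYm.aemeasurable (measurable_degExp lam t).aestronglyMeasurable, hmap,
      integral_map .of_discrete (measurable_degExp lam t).aestronglyMeasurable,
      integral_degExp_poissonMeasure _ ht]
  have hrpow : (∫ ω, degExp lam (Y ω) t ∂μ) ^ (1 - x)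
      = Real.exp (α * (1 - x) * (degExp lam 1 t - 1)) := by
    rw [hint, ← Real.exp_mul]
    ring_nf
  refine ⟨hrpow, hrpow ▸ ?_⟩
  convert! hsum using 4 with n
  rw [iteratedDeriv_exp_const_mul_comp hF (by simp [degExp_zero_right])]
  exact Finset.sum_congr rfl fun k _ ↦ by rw [iteratedDeriv_eq_of_eventually_hasSum (hdSt k)]
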